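/- Assume g satisfies conditions (2.4) and h satisfies conditions (2.5), and let N ≥ 1 be an integer. Given t₀ ≥ 0, let φ be the solution on its maximal interval (t₀, t₁) of the ODE (t^{N−1} g(φ(t)²) φ(t))' = t^{N−1} h(φ(t)²) with φ(t₀) = 0, let ψ be the inverse function of φ, and let F be an antiderivative of φ on (t₀, t₁). Then the radial function u(x) = F(|x|), defined on the annulus A = {x ∈ ℝ^N : t₀ < |x| < t₁}, is a solution of Σ_{i=1}^N ∂_i(g(q²) ∂_i u) = h(q²) in A, where q = |∇u|, and the function Φ(x) = ∫₀^{q(x)} s ψ'(s) ds − u(x) is constant on A. -/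

import Mathlib

open Set Filter

noncomputable section

/-- `G(ξ) = g(ξ) + 2ξ g'(ξ)`, from (1.2). -/
def Gfun (g : ℝ → ℝ) (ξ : ℝ) : ℝ := g ξ + 2 * ξ * deriv g ξ

/-- Conditions (2.4) on `g`. -/
def Cond24 (g : ℝ → ℝ) : Prop :=
  ContDiffOn ℝ (⊤ : ℕ∞) g (Ioi 0) ∧ (∀ ξ > (0:ℝ), 0 < g ξ) ∧
  Tendsto (fun ξ : ℝ => g (ξ ^ 2) * ξ) (nhdsWithin 0 (Ioi 0)) (nhds 0) ∧
  Tendsto (fun ξ : ℝ => g (ξ ^ 2) * ξ) atTop atTop ∧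
  (∀ ξ > (0:ℝ), 0 < Gfun g ξ)

/-- Conditions (2.5) on `h`. -/
def Cond25 (h : ℝ → ℝ) : Prop :=
  ContDiffOn ℝ (⊤ : ℕ∞) h (Ici 0) ∧ (∀ ξ ≥ (0:ℝ), 0 < h ξ) ∧
  (∀ ξ ≥ (0:ℝ), 0 ≤ derivWithin h (Ici 0) ξ)

/-- `φ` is a (differentiable) solution of the ODE (2.6) on the set `s`. -/
def SolOn (N : ℕ) (g h φ : ℝ → ℝ) (s : Set ℝ) : Prop :=
  DifferentiableOn ℝ φ s ∧
  ∀ t ∈ s, HasDerivAt (fun τ : ℝ => τ ^ (N - 1) * (g (φ τ ^ 2) * φ τ))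
    (t ^ (N - 1) * h (φ t ^ 2)) t

/-- The open interval `(t₀, t₁)` where `t₁` may be `∞` (an extended real). -/
def Iint (t₀ : ℝ) (t₁ : EReal) : Set ℝ := {t : ℝ | t₀ < t ∧ (t : EReal) < t₁}

/-- The `i`-th standard basis vector of `ℝ^N`. -/
def eb (N : ℕ) (i : Fin N) : EuclideanSpace ℝ (Fin N) := EuclideanSpace.single i 1

open Topology

theorem isOpen_Iint (t₀ : ℝ) (t₁ : EReal) : IsOpen (Iint t₀ t₁) :=
  (isOpen_lt continuous_const continuous_id).inter
    (isOpen_lt continuous_coe_real_ereal continuous_const)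

theorem mem_Iint_of_le {t₀ a b : ℝ} {t₁ : EReal} (hb : b ∈ Iint t₀ t₁) (ha : t₀ < a)
    (hab : a ≤ b) : a ∈ Iint t₀ t₁ :=
  ⟨ha, lt_of_le_of_lt (EReal.coe_le_coe_iff.2 hab) hb.2⟩

theorem hasFDerivAt_norm_of_ne_zero {E : Type*} [NormedAddCommGroup E] [InnerProductSpace ℝ E]
    {x : E} (hx : x ≠ 0) : HasFDerivAt (fun y : E => ‖y‖) (‖x‖⁻¹ • innerSL ℝ x) x := by
  have hn : ‖x‖ ≠ 0 := norm_ne_zero_iff.2 hx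
  have h1 := (hasStrictFDerivAt_norm_sq x).hasFDerivAt.sqrt (pow_ne_zero 2 hn)
  simp only [Real.sqrt_sq (norm_nonneg _)] at h1
  refine h1.congr_fderiv ?_
  ext v
  simp
  field_simp

theorem HasDerivAt.hasGradientAt_comp_norm {E : Type*} [NormedAddCommGroup E]
    [InnerProductSpace ℝ E] [CompleteSpace E] {F : ℝ → ℝ} {F' : ℝ} {x : E}
    (hF : HasDerivAt F F' ‖x‖) (hx : x ≠ 0) :
    HasGradientAt (fun z : E => F ‖z‖) ((F' * ‖x‖⁻¹) • x) x := by
  have h1 := hF.comp_hasFDerivAt x (hasFDerivAt_norm_of_ne_zero hx)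
  refine HasFDerivAt.congr_fderiv (f := fun z : E => F ‖z‖) h1 ?_
  ext v
  simp [mul_assoc]

/-- The divergence of the radial vector field `V(|x|) x` is `N V(r) + r V'(r)`. -/
theorem sum_fderiv_radial_mul_coord {N : ℕ} {V : ℝ → ℝ} {V' : ℝ} {x : EuclideanSpace ℝ (Fin N)}
    (hV : HasDerivAt V V' ‖x‖) (hx : x ≠ 0) :
    ∑ i, fderiv ℝ (fun y : EuclideanSpace ℝ (Fin N) => V ‖y‖ * y i) x (eb N i)
      = N * V ‖x‖ + ‖x‖ * V' := by
  have hn : ‖x‖ ≠ 0 := norm_ne_zero_iff.2 hx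
  have key : ∀ i, fderiv ℝ (fun y : EuclideanSpace ℝ (Fin N) => V ‖y‖ * y i) x (eb N i)
      = V ‖x‖ + V' * ‖x‖⁻¹ * (x i) ^ 2 := by
    intro i
    have h1 : HasFDerivAt (fun y : EuclideanSpace ℝ (Fin N) => V ‖y‖)
        (V' • (‖x‖⁻¹ • innerSL ℝ x)) x :=
      hV.comp_hasFDerivAt x (hasFDerivAt_norm_of_ne_zero hx)
    have h2 : HasFDerivAt (fun y : EuclideanSpace ℝ (Fin N) => y i)
        (EuclideanSpace.proj i : EuclideanSpace ℝ (Fin N) →L[ℝ] ℝ) x :=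
      (EuclideanSpace.proj i : EuclideanSpace ℝ (Fin N) →L[ℝ] ℝ).hasFDerivAt
    rw [(h1.fun_mul h2).fderiv]
    simp [eb, EuclideanSpace.inner_single_right]
    ring
  simp only [key, Finset.sum_add_distrib, ← Finset.mul_sum, ← EuclideanSpace.real_norm_sq_eq]
  simp
  field_simp

theorem Cond25.monotoneOn {h : ℝ → ℝ} (hh : Cond25 h) : MonotoneOn h (Ici 0) := by
  refine monotoneOn_of_deriv_nonneg (convex_Ici 0) hh.1.continuousOn
    ((hh.1.differentiableOn (by simp)).mono interior_subset) fun x hx => ?_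
  rw [interior_Ici] at hx
  rw [← derivWithin_of_mem_nhds (Ici_mem_nhds hx)]
  exact hh.2.2 x (le_of_lt hx)

section Flux

variable {N : ℕ} {g h φ : ℝ → ℝ} {t₀ : ℝ} {t₁ : EReal}

/-- Integrated form of the equation: the flux is bounded by `h(φ(t)²) tᴺ / N`. -/
theorem flux_le (hN : 1 ≤ N) (hg : Cond24 g) (hh : Cond25 h) (ht₀ : 0 ≤ t₀)
    (hsol : SolOn N g h φ (Iint t₀ t₁)) (hcont₀ : Tendsto φ (𝓝[>] t₀) (𝓝 0))
    (hmono : StrictMonoOn φ (Iint t₀ t₁)) (hpos : ∀ t ∈ Iint t₀ t₁, 0 < φ t)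
    {t : ℝ} (ht : t ∈ Iint t₀ t₁) :
    t ^ (N - 1) * (g (φ t ^ 2) * φ t) ≤ h (φ t ^ 2) * (t ^ N / N) := by
  have hN0 : (N : ℝ) ≠ 0 := by positivity
  set K : ℝ → ℝ := fun τ => τ ^ (N - 1) * (g (φ τ ^ 2) * φ τ) - h (φ t ^ 2) * (τ ^ N / N) with hK
  have hmem : ∀ τ ∈ Ioc t₀ t, τ ∈ Iint t₀ t₁ := fun τ hτ => mem_Iint_of_le ht hτ.1 hτ.2
  have hKd : ∀ τ ∈ Ioc t₀ t, HasDerivAt K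
      (τ ^ (N - 1) * h (φ τ ^ 2) - h (φ t ^ 2) * τ ^ (N - 1)) τ := by
    intro τ hτ
    refine (hsol.2 τ (hmem τ hτ)).sub ?_
    refine (((hasDerivAt_pow N τ).div_const (N : ℝ)).const_mul (h (φ t ^ 2))).congr_deriv ?_
    field_simp
  have hanti : AntitoneOn K (Ioc t₀ t) := by
    refine antitoneOn_of_deriv_nonpos (convex_Ioc _ _)
      (fun τ hτ => (hKd τ hτ).continuousAt.continuousWithinAt)
      (fun τ hτ => (hKd τ (interior_subset hτ)).differentiableAt.differentiableWithinAt) ?_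
    intro τ hτ
    have hτ' := interior_subset hτ
    rw [(hKd τ hτ').deriv]
    have h1 : φ τ ≤ φ t := hmono.monotoneOn (hmem τ hτ') ht hτ'.2
    have h2 : h (φ τ ^ 2) ≤ h (φ t ^ 2) :=
      hh.monotoneOn (mem_Ici.2 (sq_nonneg _)) (mem_Ici.2 (sq_nonneg _))
      (pow_le_pow_left₀ (hpos τ (hmem τ hτ')).le h1 2)
    have h3 : 0 ≤ τ ^ (N - 1) := pow_nonneg (ht₀.trans hτ'.1.le) _
    nlinarith
  have hev : ∀ᶠ τ in 𝓝[>] t₀, τ ∈ Ioc t₀ t := Ioc_mem_nhdsGT ht.1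
  have hφ : Tendsto φ (𝓝[>] t₀) (𝓝[>] 0) :=
    tendsto_nhdsWithin_iff.2 ⟨hcont₀, hev.mono fun τ hτ => hpos τ (hmem τ hτ)⟩
  have hlim : Tendsto K (𝓝[>] t₀)
      (𝓝 (t₀ ^ (N - 1) * 0 - h (φ t ^ 2) * (t₀ ^ N / N))) := by
    refine Tendsto.sub (Tendsto.mul ?_ (hg.2.2.1.comp hφ)) ?_
    · exact ((continuous_pow (N - 1)).tendsto t₀).mono_left nhdsWithin_le_nhds
    · refine Tendsto.mono_left ?_ nhdsWithin_le_nhds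
      exact (((continuous_pow N).div_const (N : ℝ)).const_mul (h (φ t ^ 2))).tendsto t₀
  have hle := ge_of_tendsto hlim (hev.mono fun τ hτ => hanti hτ ⟨ht.1, le_rfl⟩ hτ.2)
  have h4 : 0 ≤ h (φ t ^ 2) * (t₀ ^ N / N) :=
    mul_nonneg (hh.2.1 _ (sq_nonneg _)).le (by positivity)
  simp only [hK] at hle
  linarith

theorem deriv_ne_zero_of_solOn (hN : 1 ≤ N) (hg : Cond24 g) (hh : Cond25 h) (ht₀ : 0 ≤ t₀)
    (hsol : SolOn N g h φ (Iint t₀ t₁)) (hcont₀ : Tendsto φ (𝓝[>] t₀) (𝓝 0))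
    (hmono : StrictMonoOn φ (Iint t₀ t₁)) (hpos : ∀ t ∈ Iint t₀ t₁, 0 < φ t)
    {t : ℝ} (ht : t ∈ Iint t₀ t₁) : deriv φ t ≠ 0 := by
  intro h0
  have hφ : HasDerivAt φ 0 t := h0 ▸
    (hsol.1.differentiableAt ((isOpen_Iint t₀ t₁).mem_nhds ht)).hasDerivAt
  have hp := hpos t ht
  have htpos : 0 < t := ht₀.trans_lt ht.1
  have hgd : HasDerivAt g (deriv g (φ t ^ 2)) (φ t ^ 2) :=
    ((hg.1.differentiableOn (by simp)).differentiableAt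
      (Ioi_mem_nhds (by positivity : (0 : ℝ) < φ t ^ 2))).hasDerivAt
  have hgφ : HasDerivAt (fun τ => g (φ τ ^ 2)) (deriv g (φ t ^ 2) * (2 * φ t ^ (2 - 1) * 0)) t :=
    hgd.comp t (hφ.fun_pow 2)
  have heq := (hsol.2 t ht).unique ((hasDerivAt_pow (N - 1) t).mul (hgφ.mul hφ))
  have hle := flux_le hN hg hh ht₀ hsol hcont₀ hmono hpos ht
  have hhpos := hh.2.1 (φ t ^ 2) (sq_nonneg _)
  obtain ⟨n, rfl⟩ : ∃ n, N = n + 1 := ⟨N - 1, by omega⟩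
  simp only [Nat.add_sub_cancel, mul_zero, zero_mul, add_zero] at heq hle
  have h1 : (n : ℝ) * (t ^ n * (g (φ t ^ 2) * φ t)) = h (φ t ^ 2) * t ^ (n + 1) := by
    rcases n with _ | m
    · simp at heq
      exact absurd heq hhpos.ne'
    · simp only [Nat.add_sub_cancel] at heq
      linear_combination (-t) * heq
  have h2 : 0 < h (φ t ^ 2) * t ^ (n + 1) := by positivity
  have h3 := mul_le_mul_of_nonneg_left hle (Nat.cast_nonneg (α := ℝ) n)
  rw [h1, mul_div_assoc', mul_div_assoc', le_div_iff₀ (by positivity)] at h3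
  push_cast at h3
  linarith

end Flux

/-- A function with bounded derivative near the left endpoint of an interval has a limit there. -/
theorem exists_tendsto_nhdsGT_of_hasDerivAt_le {F F' : ℝ → ℝ} {a b C : ℝ} (hab : a < b)
    (hF : ∀ t ∈ Ioc a b, HasDerivAt F (F' t) t) (hC : ∀ t ∈ Ioc a b, |F' t| ≤ C) :
    ∃ L, Tendsto F (𝓝[>] a) (𝓝 L) := by
  have hlip : LipschitzOnWith C.toNNReal F (Ioc a b) := by
    refine (convex_Ioc a b).lipschitzOnWith_of_nnnorm_hasDerivWithin_le
      (fun t ht => (hF t ht).hasDerivWithinAt) fun t ht => ?_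
    rw [← NNReal.coe_le_coe]
    exact (hC t ht).trans (Real.le_coe_toNNReal C)
  obtain ⟨E, hE, hEq⟩ := hlip.extend_real
  refine ⟨E a, ((hE.continuous.tendsto a).mono_left nhdsWithin_le_nhds).congr' ?_⟩
  filter_upwards [Ioc_mem_nhdsGT hab] with t ht using (hEq ht).symm

theorem integral_eq_sub_of_hasDerivAt_of_nonneg_of_tendsto {P P' : ℝ → ℝ} {a b L : ℝ}
    (hab : a < b) (hP : ∀ s ∈ Ioc a b, HasDerivAt P (P' s) s) (hP' : ∀ s ∈ Ioc a b, 0 ≤ P' s)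
    (hL : Tendsto P (𝓝[>] a) (𝓝 L)) : ∫ s in a..b, P' s = P b - L := by
  have hcont : ContinuousOn (Function.update P a L) (Icc a b) := by
    rw [continuousOn_update_iff, Icc_sdiff_left]
    exact ⟨fun s hs => (hP s hs).continuousAt.continuousWithinAt,
      fun _ => hL.mono_left (nhdsWithin_mono _ fun s hs => hs.1)⟩
  have hd : ∀ s ∈ Ioo a b, HasDerivAt (Function.update P a L) (P' s) s := by
    intro s hs
    refine (hP s ⟨hs.1, hs.2.le⟩).congr_of_eventuallyEq ?_
    filter_upwards [isOpen_ne.mem_nhds hs.1.ne'] with r hr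
    exact Function.update_of_ne hr _ _
  have hint : IntervalIntegrable P' MeasureTheory.volume a b :=
    (intervalIntegrable_iff_integrableOn_Ioc_of_le hab.le).2
      (intervalIntegral.integrableOn_deriv_of_nonneg hcont hd
        fun s hs => hP' s ⟨hs.1, hs.2.le⟩)
  rw [intervalIntegral.integral_eq_sub_of_hasDerivAt_of_le hab.le hcont hd hint,
    Function.update_of_ne hab.ne', Function.update_self]

/-- Second part of the paper's Theorem 2.1: with `φ` the solution of (2.6) on its
maximal interval `(t₀, t₁)` with `φ(t₀) = 0`, `ψ` the inverse of `φ`, and `F` an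
antiderivative of `φ`, the radial function `u(x) = F(|x|)` solves
`(g(q²)uᵢ)ᵢ = h(q²)` in the annulus `A = {t₀ < |x| < t₁}`, and
`Φ = ∫₀^q s ψ'(s) ds − u` is constant on `A`. -/
theorem stmt7 (N : ℕ) (hN : 1 ≤ N) (g h : ℝ → ℝ) (hg : Cond24 g) (hh : Cond25 h)
    (t₀ : ℝ) (ht₀ : 0 ≤ t₀) (t₁ : EReal) (ht₁ : (t₀ : EReal) < t₁)
    (φ ψ : ℝ → ℝ)
    (hsol : SolOn N g h φ (Iint t₀ t₁))
    (hcont₀ : Tendsto φ (nhdsWithin t₀ (Ioi t₀)) (nhds 0))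
    (hmono : StrictMonoOn φ (Iint t₀ t₁))
    (hrange : φ '' (Iint t₀ t₁) = Ioi 0)
    (hψl : ∀ t ∈ Iint t₀ t₁, ψ (φ t) = t)
    (hψr : ∀ s ∈ Ioi (0:ℝ), ψ s ∈ Iint t₀ t₁ ∧ φ (ψ s) = s)
    (F : ℝ → ℝ) (hF : ∀ t ∈ Iint t₀ t₁, HasDerivAt F (φ t) t) :
    (∀ x : EuclideanSpace ℝ (Fin N), ‖x‖ ∈ Iint t₀ t₁ →
      ∑ i, fderiv ℝ (fun y => g (‖gradient (fun z : EuclideanSpace ℝ (Fin N) => F ‖z‖) y‖ ^ 2)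
          * fderiv ℝ (fun z : EuclideanSpace ℝ (Fin N) => F ‖z‖) y (eb N i)) x (eb N i)
        = h (‖gradient (fun z : EuclideanSpace ℝ (Fin N) => F ‖z‖) x‖ ^ 2)) ∧
    ∃ c : ℝ, ∀ x : EuclideanSpace ℝ (Fin N), ‖x‖ ∈ Iint t₀ t₁ →
      (∫ s in (0:ℝ)..‖gradient (fun z : EuclideanSpace ℝ (Fin N) => F ‖z‖) x‖,
        s * deriv ψ s) - F ‖x‖ = c := by
  have hpos : ∀ t ∈ Iint t₀ t₁, 0 < φ t := fun t ht =>
    hrange.subset (mem_image_of_mem φ ht)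
  have hopen := isOpen_Iint t₀ t₁
  have hne : ∀ x : EuclideanSpace ℝ (Fin N), ‖x‖ ∈ Iint t₀ t₁ → x ≠ 0 := fun x hx =>
    norm_pos_iff.1 (ht₀.trans_lt hx.1)
  have hgrad : ∀ x : EuclideanSpace ℝ (Fin N), ‖x‖ ∈ Iint t₀ t₁ →
      HasGradientAt (fun z : EuclideanSpace ℝ (Fin N) => F ‖z‖) ((φ ‖x‖ * ‖x‖⁻¹) • x) x :=
    fun x hx => (hF _ hx).hasGradientAt_comp_norm (hne x hx)
  have hq : ∀ x : EuclideanSpace ℝ (Fin N), ‖x‖ ∈ Iint t₀ t₁ →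
      ‖gradient (fun z : EuclideanSpace ℝ (Fin N) => F ‖z‖) x‖ = φ ‖x‖ := by
    intro x hx
    have hn : ‖x‖ ≠ 0 := norm_ne_zero_iff.2 (hne x hx)
    rw [(hgrad x hx).gradient, norm_smul, norm_mul, norm_inv, norm_norm,
      Real.norm_of_nonneg (hpos _ hx).le, inv_mul_cancel_right₀ hn]
  constructor
  · intro x hx
    have hn : ‖x‖ ≠ 0 := norm_ne_zero_iff.2 (hne x hx)
    have hV := (hsol.2 _ hx).mul ((hasDerivAt_pow N ‖x‖).inv (pow_ne_zero N hn))
    have hflux : ∀ i, (fun y => g (‖gradient (fun z : EuclideanSpace ℝ (Fin N) => F ‖z‖) y‖ ^ 2)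
          * fderiv ℝ (fun z : EuclideanSpace ℝ (Fin N) => F ‖z‖) y (eb N i)) =ᶠ[𝓝 x]
        fun y => ((fun τ : ℝ => τ ^ (N - 1) * (g (φ τ ^ 2) * φ τ)) * (fun τ : ℝ => τ ^ N)⁻¹) ‖y‖
          * y i := by
      intro i
      filter_upwards [(hopen.preimage continuous_norm).mem_nhds hx] with y hy
      have hny : ‖y‖ ≠ 0 := norm_ne_zero_iff.2 (hne y hy)
      rw [hq y hy, (hgrad y hy).hasFDerivAt.fderiv]
      simp only [InnerProductSpace.toDual_apply_apply, eb, inner_smul_left,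
        EuclideanSpace.inner_single_right, Pi.mul_apply, Pi.inv_apply]
      obtain ⟨n, rfl⟩ : ∃ n, N = n + 1 := ⟨N - 1, by omega⟩
      simp
      field_simp
      ring
    simp only [(hflux _).fderiv_eq]
    rw [sum_fderiv_radial_mul_coord hV (hne x hx), hq x hx]
    obtain ⟨n, rfl⟩ : ∃ n, N = n + 1 := ⟨N - 1, by omega⟩
    simp only [Pi.mul_apply, Pi.inv_apply, Nat.add_sub_cancel]
    push_cast
    field_simp
    ring
  · have hψmono : StrictMonoOn ψ (Ioi 0) := by
      intro a ha b hb hab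
      rw [← hmono.lt_iff_lt (hψr a ha).1 (hψr b hb).1, (hψr a ha).2, (hψr b hb).2]
      exact hab
    have hψimg : Iint t₀ t₁ ⊆ ψ '' Ioi 0 := fun t ht => ⟨φ t, hpos t ht, hψl t ht⟩
    have hψd : ∀ s ∈ Ioi (0 : ℝ), HasDerivAt ψ (deriv ψ s) s := by
      intro s hs
      have hφd := (hsol.1.differentiableAt (hopen.mem_nhds (hψr s hs).1)).hasDerivAt
      have hcont : ContinuousAt ψ s := hψmono.continuousAt_of_image_mem_nhds (Ioi_mem_nhds hs)
        (mem_of_superset (hopen.mem_nhds (hψr s hs).1) hψimg)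
      exact (hφd.of_local_left_inverse hcont
        (deriv_ne_zero_of_solOn hN hg hh ht₀ hsol hcont₀ hmono hpos (hψr s hs).1)
        (mem_of_superset (Ioi_mem_nhds hs) fun r hr => (hψr r hr).2)).differentiableAt.hasDerivAt
    have hψ' : ∀ s ∈ Ioi (0 : ℝ), 0 ≤ deriv ψ s := fun s hs => by
      rw [← derivWithin_of_isOpen isOpen_Ioi hs]
      exact hψmono.monotoneOn.derivWithin_nonneg
    have hP : ∀ s ∈ Ioi (0 : ℝ), HasDerivAt (F ∘ ψ) (s * deriv ψ s) s := fun s hs => by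
      have := (hF _ (hψr s hs).1).comp s (hψd s hs)
      rwa [(hψr s hs).2] at this
    have hψlim : Tendsto ψ (𝓝[>] 0) (𝓝[>] t₀) := by
      refine tendsto_nhdsWithin_iff.2 ⟨tendsto_order.2 ⟨fun a ha => ?_, fun a ha => ?_⟩, ?_⟩
      · filter_upwards [self_mem_nhdsWithin] with s hs using ha.trans (hψr s hs).1.1
      · have hm : min a (ψ 1) ∈ Iint t₀ t₁ := mem_Iint_of_le (hψr 1 (mem_Ioi.2 one_pos)).1
          (lt_min ha (hψr 1 (mem_Ioi.2 one_pos)).1.1) (min_le_right _ _)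
        filter_upwards [Ioo_mem_nhdsGT (hpos _ hm)] with s hs
        have := hψmono hs.1 (hpos _ hm) hs.2
        rw [hψl _ hm] at this
        exact this.trans_le (min_le_left _ _)
      · filter_upwards [self_mem_nhdsWithin] with s hs using (hψr s hs).1.1
    have hb := (hψr 1 (mem_Ioi.2 one_pos)).1
    obtain ⟨L, hL⟩ : ∃ L, Tendsto F (𝓝[>] t₀) (𝓝 L) := by
      refine exists_tendsto_nhdsGT_of_hasDerivAt_le (C := φ (ψ 1)) hb.1
        (fun t ht => hF t (mem_Iint_of_le hb ht.1 ht.2)) fun t ht => ?_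
      have hm := mem_Iint_of_le hb ht.1 ht.2
      rw [abs_of_pos (hpos t hm)]
      exact hmono.monotoneOn hm hb ht.2
    refine ⟨-L, fun x hx => ?_⟩
    rw [hq x hx, integral_eq_sub_of_hasDerivAt_of_nonneg_of_tendsto (hpos _ hx)
      (fun s hs => hP s hs.1) (fun s hs => mul_nonneg hs.1.le (hψ' s hs.1)) (hL.comp hψlim),
      Function.comp_apply, hψl _ hx]
    ring

end
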